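/- Let f be a nonnegative real-valued multiplicative arithmetic function with ρ(p) = sup_{ν≥0} f(p^ν) < ∞ for all primes p. Suppose the product R = ∏_p (1 - 1/p)ρ(p) converges (improper limits allowed) and ρ(p) ≤ 1 + o(log p / p) as p → ∞. Then limsup_{n→∞} f(n)/log log n ≤ e^γ · R. -/

import Mathlib

open Filter Real
open scoped ENNReal

/-- `∑ p ≤ N, log p / p`. -/
noncomputable def sumLogPrimeDiv (N : ℕ) : ℝ := ∑ p ∈ N.primesLE, Real.log p / p

lemma log_factorial_eq_sum_primesLE (N : ℕ) :
    Real.log (N.factorial : ℝ) =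
      ∑ p ∈ N.primesLE, (N.factorial.factorization p : ℝ) * Real.log p := by
  rw [Real.log_nat_eq_sum_factorization]
  refine Finset.sum_subset (fun p hp => ?_) (fun p _ hp => ?_)
  · rw [Nat.support_factorization, Nat.mem_primeFactors] at hp
    exact Nat.mem_primesLE.mpr ⟨(hp.1.dvd_factorial).mp hp.2.1, hp.1⟩
  · rw [Finsupp.notMem_support_iff] at hp
    simp [hp]

lemma log_div_sub_one_sub_log_div_le {p : ℕ} (hp : 2 ≤ p) :
    Real.log p / (p - 1) - Real.log p / p ≤ 4 * (p : ℝ) ^ (-(3 / 2) : ℝ) := by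
  have h2 : (2 : ℝ) ≤ p := by exact_mod_cast hp
  have h0 : (0 : ℝ) < p := by linarith
  have hlog : Real.log p ≤ 2 * (p : ℝ) ^ (1 / 2 : ℝ) := by
    have := Real.log_le_rpow_div h0.le (ε := 1 / 2) (by norm_num)
    linarith
  have hl0 : 0 ≤ Real.log p := Real.log_nonneg (by linarith)
  have e : (p : ℝ) ^ (-(3 / 2) : ℝ) = (p : ℝ) ^ (1 / 2 : ℝ) / (p : ℝ) ^ 2 := by
    rw [← Real.rpow_natCast, ← Real.rpow_sub h0]
    norm_num
  rw [e, div_sub_div _ _ (by linarith) h0.ne', ← mul_div_assoc,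
    div_le_div_iff₀ (by nlinarith) (by positivity)]
  have h3 : (p : ℝ) ^ 2 ≤ 2 * ((p - 1) * p) := by nlinarith
  calc (Real.log p * p - (p - 1) * Real.log p) * (p : ℝ) ^ 2 = Real.log p * (p : ℝ) ^ 2 := by ring
    _ ≤ (2 * (p : ℝ) ^ (1 / 2 : ℝ)) * (2 * ((p - 1) * p)) := by gcongr
    _ = _ := by ring

/-- **Mertens' first theorem.** -/
lemma exists_abs_sumLogPrimeDiv_sub_log_le :
    ∃ C, ∀ N : ℕ, N ≠ 0 → |sumLogPrimeDiv N - Real.log N| ≤ C := by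
  have hsum : Summable fun n : ℕ => 4 * (n : ℝ) ^ (-(3 / 2) : ℝ) :=
    (Real.summable_nat_rpow.mpr (by norm_num)).mul_left 4
  set K := ∑' n : ℕ, 4 * (n : ℝ) ^ (-(3 / 2) : ℝ) with hK
  refine ⟨max (1 + K) (Real.log 4), fun N hN => ?_⟩
  have hN0 : (0 : ℝ) < N := by positivity
  have hlower : N * Real.log N - N ≤ Real.log (N.factorial : ℝ) := by
    have := Stirling.le_log_factorial_stirling hN
    have h1 : 0 ≤ Real.log N := Real.log_natCast_nonneg N
    have h2 : 0 ≤ Real.log (2 * π) := Real.log_nonneg (by linarith [Real.pi_gt_three])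
    linarith
  have hupper : Real.log (N.factorial : ℝ) ≤ N * Real.log N := by
    rw [← Real.log_pow]
    exact Real.log_le_log (by positivity) (by exact_mod_cast Nat.factorial_le_pow N)
  have htheta : ∑ p ∈ N.primesLE, Real.log p ≤ Real.log 4 * N := by
    rw [← Chebyshev.theta_eq_sum_primesLE_log]
    exact Chebyshev.theta_le_log4_mul_x hN0.le
  have hA : N * sumLogPrimeDiv N - ∑ p ∈ N.primesLE, Real.log p ≤ Real.log (N.factorial : ℝ) := by
    rw [log_factorial_eq_sum_primesLE, sumLogPrimeDiv, Finset.mul_sum, ← Finset.sum_sub_distrib]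
    refine Finset.sum_le_sum fun p hp => ?_
    obtain ⟨hle, hpp⟩ := Nat.mem_primesLE.mp hp
    have hf : N / p ≤ N.factorial.factorization p := by
      rw [Nat.factorization_factorial hpp (lt_add_one (Nat.log p N))]
      have h1 : 1 ∈ Finset.Ico 1 (Nat.log p N + 1) := by
        have := Nat.log_pos hpp.one_lt hle
        simp [this]
      simpa using Finset.single_le_sum (f := fun i => N / p ^ i) (fun _ _ => Nat.zero_le _) h1
    have hf' : (N : ℝ) / p - 1 ≤ N.factorial.factorization p := by
      have h1 : ((N / p : ℕ) : ℝ) ≤ N.factorial.factorization p := by exact_mod_cast hf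
      have h2 := Nat.lt_floor_add_one ((N : ℝ) / p)
      rw [Nat.floor_div_eq_div] at h2
      linarith
    have := mul_le_mul_of_nonneg_right hf' (Real.log_natCast_nonneg p)
    calc _ = ((N : ℝ) / p - 1) * Real.log p := by ring
      _ ≤ _ := this
  have hB : Real.log (N.factorial : ℝ) ≤ N * (sumLogPrimeDiv N + K) := by
    have hK' : ∑ p ∈ N.primesLE, (Real.log p / (p - 1) - Real.log p / p) ≤ K :=
      (Finset.sum_le_sum fun p hp => log_div_sub_one_sub_log_div_le (Nat.two_le_of_mem_primesLE hp)).trans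
        (hsum.sum_le_tsum _ fun n _ => by positivity)
    calc Real.log (N.factorial : ℝ) ≤ ∑ p ∈ N.primesLE, (N : ℝ) * (Real.log p / (p - 1)) := by
          rw [log_factorial_eq_sum_primesLE]
          refine Finset.sum_le_sum fun p hp => ?_
          obtain ⟨hle, hpp⟩ := Nat.mem_primesLE.mp hp
          have h1 : (N.factorial.factorization p : ℝ) ≤ ((N / (p - 1) : ℕ) : ℝ) := by
            exact_mod_cast Nat.factorization_factorial_le_div_pred hpp N
          have h2 : ((N / (p - 1) : ℕ) : ℝ) ≤ N / (p - 1) := by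
            have := Nat.cast_div_le (α := ℝ) (m := N) (n := p - 1)
            rwa [Nat.cast_sub hpp.one_le, Nat.cast_one] at this
          have := mul_le_mul_of_nonneg_right (h1.trans h2) (Real.log_natCast_nonneg p)
          calc _ ≤ _ := this
            _ = _ := by ring
      _ = N * (sumLogPrimeDiv N + ∑ p ∈ N.primesLE, (Real.log p / (p - 1) - Real.log p / p)) := by
          rw [sumLogPrimeDiv, ← Finset.sum_add_distrib, Finset.mul_sum]
          exact Finset.sum_congr rfl fun p _ => by ring
      _ ≤ _ := by gcongr
  rw [abs_le]
  constructor
  · have : (N : ℝ) * (Real.log N - 1) ≤ N * (sumLogPrimeDiv N + K) := by linarith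
    have := le_of_mul_le_mul_left this hN0
    linarith [le_max_left (1 + K) (Real.log 4)]
  · have : (N : ℝ) * sumLogPrimeDiv N ≤ N * (Real.log N + Real.log 4) := by linarith
    have := le_of_mul_le_mul_left this hN0
    linarith [le_max_right (1 + K) (Real.log 4)]

/-- The primes in `(2 ^ m, 2 ^ (m + 1)]`. -/
def dyadicPrimes (m : ℕ) : Finset ℕ := (2 ^ (m + 1)).primesLE \ (2 ^ m).primesLE

lemma mem_dyadicPrimes {m p : ℕ} :
    p ∈ dyadicPrimes m ↔ p.Prime ∧ 2 ^ m < p ∧ p ≤ 2 ^ (m + 1) := by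
  simp only [dyadicPrimes, Finset.mem_sdiff, Nat.mem_primesLE]
  grind

lemma sum_dyadicPrimes (g : ℕ → ℝ) (m : ℕ) :
    ∑ p ∈ dyadicPrimes m, g p =
      ∑ p ∈ (2 ^ (m + 1)).primesLE, g p - ∑ p ∈ (2 ^ m).primesLE, g p :=
  Finset.sum_sdiff_eq_sub (Nat.primesLE_mono (Nat.pow_le_pow_right (by norm_num) m.le_succ))

lemma sum_range_sum_dyadicPrimes (g : ℕ → ℝ) (N : ℕ) :
    ∑ m ∈ Finset.range N, ∑ p ∈ dyadicPrimes m, g p = ∑ p ∈ (2 ^ N).primesLE, g p := by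
  simp_rw [sum_dyadicPrimes]
  have := Finset.sum_range_sub (fun m : ℕ => ∑ p ∈ (2 ^ m).primesLE, g p) N
  simpa using this

lemma log_le_of_mem_dyadicPrimes {m p : ℕ} (hp : p ∈ dyadicPrimes m) :
    Real.log p ≤ (m + 1) * Real.log 2 := by
  obtain ⟨hpp, -, h⟩ := mem_dyadicPrimes.mp hp
  have h1 : (p : ℝ) ≤ 2 ^ (m + 1) := by exact_mod_cast h
  have := Real.log_le_log (by exact_mod_cast hpp.pos) h1
  rw [Real.log_pow] at this
  exact_mod_cast this

lemma le_log_of_mem_dyadicPrimes {m p : ℕ} (hp : p ∈ dyadicPrimes m) :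
    m * Real.log 2 ≤ Real.log p := by
  obtain ⟨hpp, h, -⟩ := mem_dyadicPrimes.mp hp
  have h1 : (2 : ℝ) ^ m ≤ p := by exact_mod_cast h.le
  rw [← Real.log_pow]
  exact Real.log_le_log (by positivity) h1

lemma exists_sum_dyadicPrimes_inv_le :
    ∃ K, 0 ≤ K ∧ ∀ m : ℕ, ∑ p ∈ dyadicPrimes m, 1 / (p : ℝ) ≤ K / (m + 1) := by
  obtain ⟨C, hC⟩ := exists_abs_sumLogPrimeDiv_sub_log_le
  have hl2 : 0 < Real.log 2 := Real.log_pos (by norm_num)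
  have hC0 : 0 ≤ C := (abs_nonneg _).trans (hC 1 one_ne_zero)
  refine ⟨(2 * C + Real.log 2) * 2 / Real.log 2, by positivity, fun m => ?_⟩
  have h1 : ∑ p ∈ dyadicPrimes m, Real.log p / p ≤ 2 * C + Real.log 2 := by
    rw [sum_dyadicPrimes]
    have ha := abs_le.mp (hC (2 ^ (m + 1)) (by positivity))
    have hb := abs_le.mp (hC (2 ^ m) (by positivity))
    simp only [sumLogPrimeDiv, Nat.cast_pow, Real.log_pow, Nat.cast_ofNat] at ha hb
    push_cast at ha hb
    linarith
  have h2 : (m + 1) / 2 * Real.log 2 * ∑ p ∈ dyadicPrimes m, 1 / (p : ℝ) ≤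
      ∑ p ∈ dyadicPrimes m, Real.log p / p := by
    rw [Finset.mul_sum]
    refine Finset.sum_le_sum fun p hp => ?_
    rw [mul_one_div]
    gcongr
    have h3 := Real.log_le_log (by norm_num)
      (show (2 : ℝ) ≤ p by exact_mod_cast (mem_dyadicPrimes.mp hp).1.two_le)
    linarith [le_log_of_mem_dyadicPrimes hp]
  rw [div_div, le_div_iff₀ (by positivity)]
  linarith

lemma exists_tendsto_sum_dyadicPrimes_inv_sub :
    ∃ L, Tendsto (fun N => ∑ m ∈ Finset.range N,
      (∑ p ∈ dyadicPrimes m, 1 / (p : ℝ) - 1 / ((m : ℝ) + 1))) atTop (nhds L) := by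
  obtain ⟨K, hK0, hK⟩ := exists_sum_dyadicPrimes_inv_le
  obtain ⟨C, hC⟩ := exists_abs_sumLogPrimeDiv_sub_log_le
  have hl2 : 0 < Real.log 2 := Real.log_pos (by norm_num)
  set c : ℕ → ℝ := fun m => ∑ p ∈ dyadicPrimes m, 1 / (p : ℝ) with hc
  set t : ℕ → ℝ := fun m => ∑ p ∈ dyadicPrimes m, Real.log p / p with ht
  have hdir : CauchySeq fun N => ∑ m ∈ Finset.range N,
      (1 / ((m : ℝ) + 1)) • (t m / Real.log 2 - 1) := by
    refine Antitone.cauchySeq_series_mul_of_tendsto_zero_of_bounded (b := C / Real.log 2) ?_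
      tendsto_one_div_add_atTop_nhds_zero_nat fun N => ?_
    · intro a b hab
      have : (a : ℝ) ≤ b := by exact_mod_cast hab
      dsimp only
      gcongr
    · rw [Finset.sum_sub_distrib, ← Finset.sum_div, ht, sum_range_sum_dyadicPrimes]
      have := hC (2 ^ N) (by positivity)
      simp only [sumLogPrimeDiv, Nat.cast_pow, Real.log_pow, Nat.cast_ofNat] at this
      simp only [Finset.sum_const, Finset.card_range, nsmul_eq_mul, mul_one, Real.norm_eq_abs]
      rw [le_div_iff₀ hl2, ← abs_of_pos hl2, ← abs_mul, abs_of_pos hl2, sub_mul,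
        div_mul_cancel₀ _ hl2.ne']
      exact this
  have hsm : Summable fun m : ℕ => c m - t m / ((m + 1) * Real.log 2) := by
    have hs : Summable fun m : ℕ => K * (1 / ((m : ℝ) + 1) ^ 2) := by
      refine Summable.mul_left K ?_
      have := (summable_nat_add_iff 1).mpr (Real.summable_one_div_nat_pow.mpr one_lt_two)
      simpa using this
    have hterm (m : ℕ) : c m - t m / ((m + 1) * Real.log 2) =
        ∑ p ∈ dyadicPrimes m, (1 - Real.log p / ((m + 1) * Real.log 2)) * (1 / (p : ℝ)) := by
      rw [hc, ht, Finset.sum_div, ← Finset.sum_sub_distrib]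
      exact Finset.sum_congr rfl fun p _ => by ring
    refine Summable.of_nonneg_of_le (fun m => ?_) (fun m => ?_) hs
    · rw [hterm]
      refine Finset.sum_nonneg fun p hp => mul_nonneg ?_ (by positivity)
      rw [sub_nonneg, div_le_one (by positivity)]
      exact log_le_of_mem_dyadicPrimes hp
    · calc _ ≤ ∑ p ∈ dyadicPrimes m, 1 / ((m : ℝ) + 1) * (1 / (p : ℝ)) := by
            rw [hterm]
            refine Finset.sum_le_sum fun p hp => ?_
            gcongr
            rw [sub_le_iff_le_add, ← sub_le_iff_le_add', le_div_iff₀ (by positivity)]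
            have h := le_log_of_mem_dyadicPrimes hp
            calc (1 - 1 / ((m : ℝ) + 1)) * ((m + 1) * Real.log 2) = m * Real.log 2 := by
                  field_simp
                  ring
              _ ≤ _ := h
        _ = 1 / ((m : ℝ) + 1) * c m := by rw [hc, Finset.mul_sum]
        _ ≤ 1 / ((m : ℝ) + 1) * (K / (m + 1)) := by gcongr; exact hK m
        _ = _ := by field_simp
  obtain ⟨L, hL⟩ := cauchySeq_tendsto_of_complete hdir
  refine ⟨_, (hsm.hasSum.tendsto_sum_nat.add hL).congr fun N => ?_⟩
  rw [← Finset.sum_add_distrib]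
  refine Finset.sum_congr rfl fun m _ => ?_
  rw [smul_eq_mul]
  have : (m : ℝ) + 1 ≠ 0 := by positivity
  field_simp
  ring

lemma sum_neg_log_one_sub_rpow_le {t : ℝ} (ht : 1 < t) (N : ℕ) :
    ∑ p ∈ N.primesLE, -Real.log (1 - (p : ℝ) ^ (-t)) ≤ Real.log (∑' n : ℕ, 1 / (n : ℝ) ^ t) := by
  let φ : ℕ →* ℝ :=
    { toFun := fun n => (n : ℝ) ^ (-t)
      map_one' := by simp
      map_mul' := fun a b => by
        push_cast
        exact Real.mul_rpow a.cast_nonneg b.cast_nonneg }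
  have hφ (n : ℕ) : φ n = (n : ℝ) ^ (-t) := rfl
  have hφ' (n : ℕ) : φ n = 1 / (n : ℝ) ^ t := by
    rw [hφ, Real.rpow_neg n.cast_nonneg, one_div]
  have hs : Summable φ := Real.summable_nat_rpow.mpr (by linarith)
  have hlt {p : ℕ} (hp : p ∈ N.primesLE) : (p : ℝ) ^ (-t) < 1 :=
    Real.rpow_lt_one_of_one_lt_of_neg (by exact_mod_cast Nat.one_lt_of_mem_primesLE hp) (by linarith)
  have hprod := EulerProduct.prod_primesBelow_geometric_eq_tsum_smoothNumbers hs (N + 1)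
  have hle : ∏ p ∈ N.primesLE, (1 - φ p)⁻¹ ≤ ∑' n : ℕ, 1 / (n : ℝ) ^ t := by
    simp_rw [← hφ']
    rw [Nat.primesLE, hprod]
    exact hs.tsum_subtype_le φ _ fun n => by rw [hφ]; positivity
  have hpos : 0 < ∏ p ∈ N.primesLE, (1 - φ p)⁻¹ :=
    Finset.prod_pos fun p hp => inv_pos.mpr (sub_pos.mpr (hlt hp))
  refine le_trans (le_of_eq ?_) (Real.log_le_log hpos hle)
  simp_rw [hφ]
  rw [Real.log_prod fun p hp => (inv_pos.mpr (sub_pos.mpr (hlt hp))).ne']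
  exact Finset.sum_congr rfl fun p _ => (Real.log_inv _).symm

lemma tendsto_one_sub_two_rpow_neg_div :
    Tendsto (fun s : ℝ => (1 - (2 : ℝ) ^ (-s)) / s) (nhdsWithin 0 (Set.Ioi 0))
      (nhds (Real.log 2)) := by
  have h : HasDerivAt (fun s : ℝ => (1 - (2 : ℝ) ^ (-s))) (Real.log 2) 0 := by
    have h1 := ((hasDerivAt_neg (0 : ℝ)).const_rpow (a := 2) (by norm_num)).const_sub 1
    simpa using h1
  refine h.tendsto_slope_zero_right.congr fun s => ?_
  simp [div_eq_inv_mul]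

lemma sum_dyadicPrimes_mul_add_le {s : ℝ} (hs : 0 < s) {K N : ℕ} (hKN : K ≤ 2 ^ N) :
    ∑ m ∈ Finset.range N, (∑ p ∈ dyadicPrimes m, 1 / (p : ℝ)) * ((2 : ℝ) ^ (-s)) ^ (m + 1) +
      ∑ p ∈ K.primesLE, (-Real.log (1 - (p : ℝ) ^ (-(1 + s))) - (p : ℝ) ^ (-(1 + s))) ≤
    Real.log (∑' n : ℕ, 1 / (n : ℝ) ^ (1 + s)) := by
  have h1 : ∑ m ∈ Finset.range N, (∑ p ∈ dyadicPrimes m, 1 / (p : ℝ)) * ((2 : ℝ) ^ (-s)) ^ (m + 1) ≤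
      ∑ p ∈ Nat.primesLE (2 ^ N), (p : ℝ) ^ (-(1 + s)) := by
    rw [← sum_range_sum_dyadicPrimes]
    refine Finset.sum_le_sum fun m _ => ?_
    rw [Finset.sum_mul]
    refine Finset.sum_le_sum fun p hp => ?_
    obtain ⟨hpp, -, h⟩ := mem_dyadicPrimes.mp hp
    have hp0 : (0 : ℝ) < p := by exact_mod_cast hpp.pos
    have hle : (p : ℝ) ≤ 2 ^ (m + 1) := by exact_mod_cast h
    have e : (p : ℝ) ^ (-(1 + s)) = 1 / (p : ℝ) * (p : ℝ) ^ (-s) := by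
      rw [neg_add, Real.rpow_add hp0, Real.rpow_neg_one, one_div]
    rw [e]
    gcongr
    rw [← Real.rpow_mul_natCast (by norm_num), mul_comm, Real.rpow_natCast_mul (by norm_num)]
    exact Real.rpow_le_rpow_of_nonpos hp0 hle (by linarith)
  have h2 : ∑ p ∈ K.primesLE, (-Real.log (1 - (p : ℝ) ^ (-(1 + s))) - (p : ℝ) ^ (-(1 + s))) ≤
      ∑ p ∈ Nat.primesLE (2 ^ N), (-Real.log (1 - (p : ℝ) ^ (-(1 + s))) - (p : ℝ) ^ (-(1 + s))) := by
    refine Finset.sum_le_sum_of_subset_of_nonneg (Nat.primesLE_mono hKN) fun p hp _ => ?_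
    have hlt : (p : ℝ) ^ (-(1 + s)) < 1 :=
      Real.rpow_lt_one_of_one_lt_of_neg (by exact_mod_cast Nat.one_lt_of_mem_primesLE hp)
        (by linarith)
    linarith [Real.log_le_sub_one_of_pos (sub_pos.mpr hlt)]
  have h3 := sum_neg_log_one_sub_rpow_le (show 1 < 1 + s by linarith) (2 ^ N)
  rw [Finset.sum_sub_distrib] at h2
  rw [Finset.sum_sub_distrib] at h2 ⊢
  linarith

lemma add_sum_neg_log_sub_inv_le {L : ℝ}
    (hL : Tendsto (fun N => ∑ m ∈ Finset.range N,
      (∑ p ∈ dyadicPrimes m, 1 / (p : ℝ) - 1 / ((m : ℝ) + 1))) atTop (nhds L)) (K : ℕ) :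
    L + ∑ p ∈ K.primesLE, (-Real.log (1 - 1 / (p : ℝ)) - 1 / (p : ℝ)) ≤
      Real.log (Real.log 2) := by
  set f : ℕ → ℝ := fun m => ∑ p ∈ dyadicPrimes m, 1 / (p : ℝ) - 1 / ((m : ℝ) + 1) with hf
  have hl2 : 0 < Real.log 2 := Real.log_pos (by norm_num)
  have hfb : ∃ B, ∀ m, |f m| ≤ B := by
    obtain ⟨B, hB0, hB⟩ := exists_sum_dyadicPrimes_inv_le
    refine ⟨B + 1, fun m => (abs_sub _ _).trans ?_⟩
    have hm : (1 : ℝ) ≤ m + 1 := by simp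
    rw [abs_of_nonneg (by positivity), abs_of_nonneg (by positivity)]
    exact add_le_add ((hB m).trans (div_le_self hB0 hm)) (div_le_self zero_le_one hm)
  obtain ⟨B, hB⟩ := hfb
  have hx (s : ℝ) (hs : 0 < s) : (2 : ℝ) ^ (-s) < 1 :=
    Real.rpow_lt_one_of_one_lt_of_neg (by norm_num) (by linarith)
  have hkey : ∀ s : ℝ, 0 < s → (2 : ℝ) ^ (-s) * ∑' m, f m * ((2 : ℝ) ^ (-s)) ^ m +
      ∑ p ∈ K.primesLE, (-Real.log (1 - (p : ℝ) ^ (-(1 + s))) - (p : ℝ) ^ (-(1 + s))) ≤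
      Real.log (∑' n : ℕ, 1 / (n : ℝ) ^ (1 + s)) + Real.log (1 - (2 : ℝ) ^ (-s)) := by
    intro s hs
    set x : ℝ := (2 : ℝ) ^ (-s) with hxdef
    have hx0 : 0 < x := by positivity
    have hx1 : |x| < 1 := by rw [abs_of_pos hx0]; exact hx s hs
    have hsum : Summable fun m => f m * x ^ m := by
      refine Summable.of_norm_bounded ((summable_geometric_of_abs_lt_one hx1).mul_left B) fun m => ?_
      rw [Real.norm_eq_abs, abs_mul, abs_of_pos (pow_pos hx0 m)]
      gcongr
      exact hB m
    have hlim := ((hsum.hasSum.mul_left x).add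
      (Real.hasSum_pow_div_log_of_abs_lt_one hx1)).tendsto_sum_nat
    have hle := le_of_tendsto (hlim.add_const (∑ p ∈ K.primesLE,
      (-Real.log (1 - (p : ℝ) ^ (-(1 + s))) - (p : ℝ) ^ (-(1 + s)))))
      (b := Real.log (∑' n : ℕ, 1 / (n : ℝ) ^ (1 + s))) ?_
    · linarith
    · filter_upwards [eventually_ge_atTop K] with N hN
      refine le_trans (le_of_eq ?_)
        (sum_dyadicPrimes_mul_add_le hs (hN.trans Nat.lt_two_pow_self.le))
      congr 1
      refine Finset.sum_congr rfl fun m _ => ?_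
      rw [hf]
      ring
  have ht0 : Tendsto (fun s : ℝ => s) (nhdsWithin 0 (Set.Ioi 0)) (nhds 0) :=
    tendsto_id.mono_left nhdsWithin_le_nhds
  have hxlim : Tendsto (fun s : ℝ => (2 : ℝ) ^ (-s)) (nhdsWithin 0 (Set.Ioi 0)) (nhds 1) := by
    have : Tendsto (fun s : ℝ => (2 : ℝ) ^ (-s)) (nhdsWithin 0 (Set.Ioi 0)) (nhds (2 ^ (-(0:ℝ)))) :=
      tendsto_const_nhds.rpow ht0.neg (by norm_num)
    simpa using this
  have hA : Tendsto (fun s : ℝ => ∑' m, f m * ((2 : ℝ) ^ (-s)) ^ m) (nhdsWithin 0 (Set.Ioi 0))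
      (nhds L) :=
    (Real.tendsto_tsum_powerSeries_nhdsWithin_lt hL).comp
      (tendsto_nhdsWithin_iff.mpr ⟨hxlim, eventually_mem_nhdsWithin.mono fun s hs => hx s hs⟩)
  have hr : Tendsto (fun s : ℝ => ∑ p ∈ K.primesLE,
      (-Real.log (1 - (p : ℝ) ^ (-(1 + s))) - (p : ℝ) ^ (-(1 + s)))) (nhdsWithin 0 (Set.Ioi 0))
      (nhds (∑ p ∈ K.primesLE, (-Real.log (1 - 1 / (p : ℝ)) - 1 / (p : ℝ)))) := by
    refine tendsto_finsetSum _ fun p hp => ?_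
    have hp1 : (1 : ℝ) < p := by exact_mod_cast Nat.one_lt_of_mem_primesLE hp
    have hp' : Tendsto (fun s : ℝ => (p : ℝ) ^ (-(1 + s))) (nhdsWithin 0 (Set.Ioi 0))
        (nhds (1 / p)) := by
      have : Tendsto (fun s : ℝ => (p : ℝ) ^ (-(1 + s))) (nhdsWithin 0 (Set.Ioi 0))
          (nhds ((p : ℝ) ^ (-(1 + 0 : ℝ)))) :=
        tendsto_const_nhds.rpow (ht0.const_add 1).neg (Or.inl (by linarith))
      simpa [Real.rpow_neg_one] using this
    have hne : 1 - 1 / (p : ℝ) ≠ 0 := (sub_pos.mpr ((div_lt_one (by linarith)).mpr hp1)).ne'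
    exact ((hp'.const_sub 1).log hne).neg.sub hp'
  have hZ : Tendsto (fun s : ℝ => s * ∑' n : ℕ, 1 / (n : ℝ) ^ (1 + s)) (nhdsWithin 0 (Set.Ioi 0))
      (nhds 1) := by
    have h1 : Tendsto (fun s : ℝ => 1 + s) (nhdsWithin 0 (Set.Ioi 0))
        (nhdsWithin 1 (Set.Ioi 1)) :=
      tendsto_nhdsWithin_iff.mpr ⟨by simpa using ht0.const_add 1,
        eventually_mem_nhdsWithin.mono fun s (hs : 0 < s) => by simpa using hs⟩
    refine (tendsto_sub_mul_tsum_nat_rpow.comp h1).congr fun s => ?_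
    simp
  have hrhs := (hZ.log one_ne_zero).add (tendsto_one_sub_two_rpow_neg_div.log hl2.ne')
  have hlhs := (hxlim.mul hA).add hr
  rw [Real.log_one, zero_add] at hrhs
  rw [one_mul] at hlhs
  refine le_of_tendsto_of_tendsto hlhs hrhs ?_
  filter_upwards [eventually_mem_nhdsWithin] with s (hs : 0 < s)
  refine (hkey s hs).trans (le_of_eq ?_)
  have hZpos : 0 < ∑' n : ℕ, 1 / (n : ℝ) ^ (1 + s) := by
    refine (Real.summable_one_div_nat_rpow.mpr (by linarith)).tsum_pos (fun n => by positivity) 1 ?_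
    simp
  rw [Real.log_mul hs.ne' hZpos.ne', Real.log_div (sub_pos.mpr (hx s hs)).ne' hs.ne']
  ring

/-- The upper bound in **Mertens' third theorem** along powers of two. -/
lemma eventually_sum_neg_log_two_pow_le {ε : ℝ} (hε : 0 < ε) :
    ∀ᶠ N : ℕ in atTop, ∑ p ∈ Nat.primesLE (2 ^ N), -Real.log (1 - 1 / (p : ℝ)) ≤
      Real.eulerMascheroniConstant + ε + Real.log (N * Real.log 2) := by
  obtain ⟨L, hL⟩ := exists_tendsto_sum_dyadicPrimes_inv_sub
  have hl2 : 0 < Real.log 2 := Real.log_pos (by norm_num)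
  have hlim := hL.add Real.tendsto_harmonic_sub_log
  filter_upwards [hlim.eventually_lt_const (show L + Real.eulerMascheroniConstant <
    L + Real.eulerMascheroniConstant + ε by linarith), eventually_gt_atTop 0] with N hN hN0
  have hr := add_sum_neg_log_sub_inv_le hL (2 ^ N)
  have hh : (harmonic N : ℝ) = ∑ m ∈ Finset.range N, 1 / ((m : ℝ) + 1) := by
    simp [harmonic]
  rw [Finset.sum_sub_distrib, sum_range_sum_dyadicPrimes, hh] at hN
  rw [Finset.sum_sub_distrib] at hr
  rw [Real.log_mul (by positivity) hl2.ne']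
  linarith

/-- The upper bound in **Mertens' third theorem**. -/
lemma eventually_prod_one_sub_inv_le {ε : ℝ} (hε : 0 < ε) :
    ∀ᶠ n : ℕ in atTop, ∏ p ∈ n.primesLE, (1 - 1 / (p : ℝ))⁻¹ ≤
      Real.exp (Real.eulerMascheroniConstant + ε) * Real.log n := by
  have hclog : Tendsto (fun n : ℕ => Nat.clog 2 n) atTop atTop := by
    refine tendsto_atTop.mpr fun b => ?_
    filter_upwards [eventually_ge_atTop (2 ^ b)] with n hn
    exact (Nat.pow_le_pow_iff_right one_lt_two).mp (hn.trans (Nat.le_pow_clog one_lt_two n))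
  have hlog : Tendsto (fun n : ℕ => (Real.exp (ε / 2) - 1) * Real.log n) atTop atTop :=
    (Real.tendsto_log_atTop.comp tendsto_natCast_atTop_atTop).const_mul_atTop
      (sub_pos.mpr (Real.one_lt_exp_iff.mpr (by linarith)))
  filter_upwards [hclog.eventually (eventually_sum_neg_log_two_pow_le (half_pos hε)),
    hlog.eventually_ge_atTop (Real.log 2), eventually_gt_atTop 1] with n hn hn2 hn1
  have hl2 : 0 < Real.log 2 := Real.log_pos (by norm_num)
  set N := Nat.clog 2 n with hN
  have hN0 : 0 < N := Nat.clog_pos one_lt_two hn1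
  have hpos {p M : ℕ} (hp : p ∈ Nat.primesLE M) : 0 < 1 - 1 / (p : ℝ) := by
    have : (1 : ℝ) < p := by exact_mod_cast Nat.one_lt_of_mem_primesLE hp
    exact sub_pos.mpr ((div_lt_one (by linarith)).mpr this)
  have hlogn : N * Real.log 2 ≤ Real.log n + Real.log 2 := by
    have h1 : 2 ^ (N - 1) < n := Nat.pow_pred_clog_lt_self one_lt_two hn1
    have h2 : (2 : ℝ) ^ (N - 1) ≤ n := by exact_mod_cast h1.le
    have h3 := Real.log_le_log (by positivity) h2
    rw [Real.log_pow, Nat.cast_sub hN0, Nat.cast_one] at h3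
    linarith
  calc ∏ p ∈ n.primesLE, (1 - 1 / (p : ℝ))⁻¹
      = Real.exp (∑ p ∈ n.primesLE, -Real.log (1 - 1 / (p : ℝ))) := by
        rw [Real.exp_sum]
        exact Finset.prod_congr rfl fun p hp => by
          rw [Real.exp_neg, Real.exp_log (hpos hp)]
    _ ≤ Real.exp (∑ p ∈ Nat.primesLE (2 ^ N), -Real.log (1 - 1 / (p : ℝ))) := by
        refine Real.exp_le_exp.mpr (Finset.sum_le_sum_of_subset_of_nonneg
          (Nat.primesLE_mono (Nat.le_pow_clog one_lt_two n)) fun p hp _ => ?_)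
        exact neg_nonneg.mpr (Real.log_nonpos (hpos hp).le (by simp))
    _ ≤ Real.exp (Real.eulerMascheroniConstant + ε / 2 + Real.log (N * Real.log 2)) :=
        Real.exp_le_exp.mpr hn
    _ = Real.exp (Real.eulerMascheroniConstant + ε / 2) * (N * Real.log 2) := by
        rw [Real.exp_add, Real.exp_log (by positivity)]
    _ ≤ Real.exp (Real.eulerMascheroniConstant + ε / 2) * (Real.exp (ε / 2) * Real.log n) := by
        refine mul_le_mul_of_nonneg_left ?_ (Real.exp_pos _).le
        linarith
    _ = _ := by rw [← mul_assoc, ← Real.exp_add]; ring_nf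

lemma le_prod_primeFactors_of_multiplicative {f : ℕ → ℝ} (hf0 : ∀ n, 0 ≤ f n) (hf1 : f 1 = 1)
    (hfm : ∀ m n : ℕ, Nat.Coprime m n → f (m * n) = f m * f n) {ρ : ℕ → ℝ}
    (hρ : ∀ p : ℕ, p.Prime → ∀ ν, f (p ^ ν) ≤ ρ p) {n : ℕ} (hn : n ≠ 0) :
    f n ≤ ∏ p ∈ n.primeFactors, ρ p := by
  rw [Nat.multiplicative_factorization f hfm hf1 hn, Finsupp.prod, Nat.support_factorization]
  exact Finset.prod_le_prod (fun _ _ => hf0 _) fun p hp =>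
    hρ p (Nat.prime_of_mem_primeFactors hp) _

lemma prod_primeFactors_filter_gt_le {ρ : ℕ → ℝ} (hρ1 : ∀ p : ℕ, p.Prime → 1 ≤ ρ p) {ε : ℝ}
    (hε : 0 ≤ ε) {n : ℕ} (hn : 1 < n)
    (hρε : ∀ p : ℕ, p.Prime → ⌊Real.log n⌋₊ < p → ρ p ≤ 1 + ε * (Real.log p / p)) :
    ∏ p ∈ n.primeFactors.filter (fun p => ¬ p ≤ ⌊Real.log n⌋₊), ρ p ≤ Real.exp ε := by
  have hlog : 0 < Real.log n := Real.log_pos (by exact_mod_cast hn)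
  have hsum : ∑ p ∈ n.primeFactors, Real.log p ≤ Real.log n := by
    rw [← Real.log_prod fun p hp => by
      exact_mod_cast (Nat.prime_of_mem_primeFactors hp).ne_zero]
    refine Real.log_le_log (Finset.prod_pos fun p hp => by
      exact_mod_cast (Nat.prime_of_mem_primeFactors hp).pos) ?_
    rw [← Nat.cast_prod]
    exact_mod_cast Nat.le_of_dvd (by lia) n.prod_primeFactors_dvd
  calc _ ≤ ∏ p ∈ n.primeFactors.filter (fun p => ¬ p ≤ ⌊Real.log n⌋₊),
        Real.exp (ε * (Real.log p / Real.log n)) := by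
        refine Finset.prod_le_prod (fun p hp => ?_) fun p hp => ?_
        · rw [Finset.mem_filter] at hp
          linarith [hρ1 p (Nat.prime_of_mem_primeFactors hp.1)]
        · rw [Finset.mem_filter, not_le] at hp
          have hp' := Nat.prime_of_mem_primeFactors hp.1
          have h1 : Real.log p / p ≤ Real.log p / Real.log n :=
            div_le_div_of_nonneg_left (Real.log_natCast_nonneg p) hlog (Nat.lt_of_floor_lt hp.2).le
          have h2 := Real.add_one_le_exp (ε * (Real.log p / Real.log n))
          have h3 := mul_le_mul_of_nonneg_left h1 hε
          linarith [hρε p hp' hp.2]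
    _ = Real.exp (ε * ((∑ p ∈ n.primeFactors.filter (fun p => ¬ p ≤ ⌊Real.log n⌋₊), Real.log p) /
          Real.log n)) := by
        rw [← Real.exp_sum, Finset.sum_div, Finset.mul_sum]
    _ ≤ Real.exp (ε * 1) := by
        gcongr
        rw [div_le_one hlog]
        exact (Finset.sum_le_sum_of_subset_of_nonneg (Finset.filter_subset _ _)
          fun p _ _ => Real.log_natCast_nonneg p).trans hsum
    _ = Real.exp ε := by rw [mul_one]

lemma eventually_div_log_log_le {f : ℕ → ℝ} (hf0 : ∀ n, 0 ≤ f n) (hf1 : f 1 = 1)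
    (hfm : ∀ m n : ℕ, Nat.Coprime m n → f (m * n) = f m * f n) {ρ : ℕ → ℝ}
    (hρ : ∀ p : ℕ, p.Prime → ∀ ν, f (p ^ ν) ≤ ρ p)
    (hsmall : Tendsto (fun p : ℕ => (ρ p - 1) * p / Real.log p)
      (atTop ⊓ principal {p : ℕ | p.Prime}) (nhds 0)) {ε : ℝ} (hε : 0 < ε) :
    ∀ᶠ n : ℕ in atTop, f n / Real.log (Real.log n) ≤
      Real.exp (Real.eulerMascheroniConstant + ε) *
        ∏ p ∈ Nat.primesLE ⌊Real.log n⌋₊, (1 - 1 / (p : ℝ)) * ρ p := by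
  have hρ1 (p : ℕ) (hp : p.Prime) : 1 ≤ ρ p := by simpa [hf1] using hρ p hp 0
  have hlog : Tendsto (fun n : ℕ => Real.log n) atTop atTop :=
    Real.tendsto_log_atTop.comp tendsto_natCast_atTop_atTop
  have hfloor : Tendsto (fun n : ℕ => ⌊Real.log n⌋₊) atTop atTop :=
    tendsto_nat_floor_atTop.comp hlog
  obtain ⟨P, hP⟩ := eventually_atTop.mp
    (eventually_inf_principal.mp (hsmall.eventually_lt_const (half_pos hε)))
  filter_upwards [hfloor.eventually (eventually_prod_one_sub_inv_le (half_pos hε)),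
    hfloor.eventually_ge_atTop P, hfloor.eventually_ge_atTop 1, hlog.eventually_gt_atTop 1,
    eventually_gt_atTop 1] with n hM hMP hM1 hlogn hn
  set M := ⌊Real.log n⌋₊ with hMdef
  have hlarge : ∀ p : ℕ, p.Prime → M < p → ρ p ≤ 1 + ε / 2 * (Real.log p / p) := by
    intro p hp hpM
    have h := hP p (hMP.trans hpM.le) hp
    have hp0 : (0 : ℝ) < p := by exact_mod_cast hp.pos
    have hlp : 0 < Real.log p := Real.log_pos (by exact_mod_cast hp.one_lt)
    rw [div_lt_iff₀ hlp] at h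
    rw [← sub_le_iff_le_add', ← mul_div_assoc, le_div_iff₀ hp0]
    exact h.le
  have hpos {p : ℕ} (hp : p ∈ M.primesLE) : 0 < 1 - 1 / (p : ℝ) := by
    have : (1 : ℝ) < p := by exact_mod_cast Nat.one_lt_of_mem_primesLE hp
    exact sub_pos.mpr ((div_lt_one (by linarith)).mpr this)
  set Q := ∏ p ∈ M.primesLE, (1 - 1 / (p : ℝ)) * ρ p with hQ
  have hQ0 : 0 ≤ Q := Finset.prod_nonneg fun p hp =>
    mul_nonneg (hpos hp).le (zero_le_one.trans (hρ1 p (Nat.prime_of_mem_primesLE hp)))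
  have hsmallprod : ∏ p ∈ n.primeFactors.filter (fun p => p ≤ M), ρ p ≤
      Q * ∏ p ∈ M.primesLE, (1 - 1 / (p : ℝ))⁻¹ := by
    rw [hQ, ← Finset.prod_mul_distrib]
    calc _ ≤ ∏ p ∈ M.primesLE, ρ p := by
          refine Finset.prod_le_prod_of_subset_of_one_le (fun p hp => ?_) (fun p hp => ?_)
            fun p hp _ => hρ1 p (Nat.prime_of_mem_primesLE hp)
          · rw [Finset.mem_filter] at hp
            exact Nat.mem_primesLE.mpr ⟨hp.2, Nat.prime_of_mem_primeFactors hp.1⟩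
          · rw [Finset.mem_filter] at hp
            exact zero_le_one.trans (hρ1 p (Nat.prime_of_mem_primeFactors hp.1))
      _ = _ := Finset.prod_congr rfl fun p hp => by
          have := (hpos hp).ne'
          rw [mul_right_comm, mul_inv_cancel₀ this, one_mul]
  have hll : 0 < Real.log (Real.log n) := Real.log_pos hlogn
  have hlogM : Real.log M ≤ Real.log (Real.log n) :=
    Real.log_le_log (by exact_mod_cast hM1) (Nat.floor_le (by linarith))
  rw [div_le_iff₀ hll]
  calc f n ≤ ∏ p ∈ n.primeFactors, ρ p :=
        le_prod_primeFactors_of_multiplicative hf0 hf1 hfm hρ (by lia)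
    _ = (∏ p ∈ n.primeFactors.filter (fun p => p ≤ M), ρ p) *
        ∏ p ∈ n.primeFactors.filter (fun p => ¬ p ≤ M), ρ p :=
        (Finset.prod_filter_mul_prod_filter_not _ _ _).symm
    _ ≤ (Q * (Real.exp (Real.eulerMascheroniConstant + ε / 2) * Real.log (Real.log n))) *
        Real.exp (ε / 2) := by
        refine mul_le_mul (hsmallprod.trans ?_)
          (prod_primeFactors_filter_gt_le hρ1 (half_pos hε).le hn hlarge) ?_ (by positivity)
        · gcongr
          exact hM.trans (by gcongr)
        · refine Finset.prod_nonneg fun p hp => ?_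
          rw [Finset.mem_filter] at hp
          exact zero_le_one.trans (hρ1 p (Nat.prime_of_mem_primeFactors hp.1))
    _ = Real.exp (Real.eulerMascheroniConstant + ε / 2 + ε / 2) * Q * Real.log (Real.log n) := by
        rw [Real.exp_add (Real.eulerMascheroniConstant + ε / 2)]
        ring
    _ = _ := by rw [add_assoc, add_halves]

/-- **Theorem 2 (Tóth–Wirsing).** If `f` is a nonnegative multiplicative arithmetic
function, `ρ p = sup_{ν≥0} f(p^ν) < ∞` for all primes `p`, the product
`R = ∏_p (1-1/p)ρ(p)` converges in the ordered sense (improper limits allowed,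
encoded as a limit in `ℝ≥0∞`), and `ρ(p) ≤ 1 + o(log p / p)`, then
`limsup f(n)/log log n ≤ e^γ R`. -/
theorem limsup_le_of_prod_and_rho_small
    (f : ℕ → ℝ) (hf0 : ∀ n, 0 ≤ f n) (hf1 : f 1 = 1)
    (hfm : ∀ m n : ℕ, Nat.Coprime m n → f (m * n) = f m * f n)
    (ρ : ℕ → ℝ)
    (hρ : ∀ p : ℕ, p.Prime → IsLUB (Set.range fun ν : ℕ => f (p ^ ν)) (ρ p))
    (R : ℝ≥0∞)
    (hR : Filter.Tendsto (fun N : ℕ => ∏ p ∈ (Finset.range N).filter Nat.Prime,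
      ENNReal.ofReal ((1 - 1 / (p : ℝ)) * ρ p)) Filter.atTop (nhds R))
    (hsmall : Filter.Tendsto (fun p : ℕ => (ρ p - 1) * p / Real.log p)
      (Filter.atTop ⊓ Filter.principal {p : ℕ | p.Prime}) (nhds 0)) :
    Filter.limsup (fun n : ℕ => ENNReal.ofReal (f n / Real.log (Real.log n)))
      Filter.atTop ≤ ENNReal.ofReal (Real.exp Real.eulerMascheroniConstant) * R := by
  have hρle : ∀ p : ℕ, p.Prime → ∀ ν, f (p ^ ν) ≤ ρ p := fun p hp ν => (hρ p hp).1 ⟨ν, rfl⟩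
  have hM : Tendsto (fun n : ℕ => ⌊Real.log n⌋₊ + 1) atTop atTop :=
    (tendsto_add_atTop_nat 1).comp
      (tendsto_nat_floor_atTop.comp (Real.tendsto_log_atTop.comp tendsto_natCast_atTop_atTop))
  have hbound : ∀ ε : ℝ, 0 < ε →
      limsup (fun n : ℕ => ENNReal.ofReal (f n / Real.log (Real.log n))) atTop ≤
        ENNReal.ofReal (Real.exp (Real.eulerMascheroniConstant + ε)) * R := by
    intro ε hε
    have hlim := ENNReal.Tendsto.const_mul
      (a := ENNReal.ofReal (Real.exp (Real.eulerMascheroniConstant + ε)))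
      (hR.comp hM) (Or.inr ENNReal.ofReal_ne_top)
    rw [← hlim.limsup_eq]
    refine limsup_le_limsup ?_
    filter_upwards [eventually_div_log_log_le hf0 hf1 hfm hρle hsmall hε] with n hn
    refine (ENNReal.ofReal_le_ofReal hn).trans (le_of_eq ?_)
    rw [ENNReal.ofReal_mul (Real.exp_pos _).le, ENNReal.ofReal_prod_of_nonneg]
    · rfl
    · intro p hp
      have h1 : (1 : ℝ) ≤ p := by exact_mod_cast (Nat.one_lt_of_mem_primesLE hp).le
      exact mul_nonneg (sub_nonneg.mpr ((div_le_one (by linarith)).mpr h1))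
        ((hf0 _).trans (hρle p (Nat.prime_of_mem_primesLE hp) 0))
  have hlim : Tendsto
      (fun ε : ℝ => ENNReal.ofReal (Real.exp (Real.eulerMascheroniConstant + ε)) * R)
      (nhdsWithin 0 (Set.Ioi 0))
      (nhds (ENNReal.ofReal (Real.exp Real.eulerMascheroniConstant) * R)) := by
    refine ENNReal.Tendsto.mul_const (ENNReal.tendsto_ofReal ?_)
      (Or.inl (ENNReal.ofReal_pos.mpr (Real.exp_pos _)).ne')
    have : Continuous fun ε : ℝ => Real.exp (Real.eulerMascheroniConstant + ε) := by fun_prop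
    simpa using (this.tendsto 0).mono_left nhdsWithin_le_nhds
  exact ge_of_tendsto hlim (eventually_mem_nhdsWithin.mono fun ε hε => hbound ε hε)
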